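/- arXiv:2110.07784 — 2 statements merged into one kernel-verified Lean document; each statement's English description precedes it below -/
import Mathlib

section
/- Let B = {1243, 1324, 1342, 1423, 1432, 2143, 2413, 2431, 3142, 4132}. Then |S_3(B)| = 6, and for every n ≥ 1 with n ≠ 3, |S_n(B)| equals the n-th Catalan number C_n = (1/(n+1))·binom(2n, n). (Equivalently, Σ_{n≥1} |S_n(B)| x^n = x³ − 1 + C(x), where C(x) = Σ_{n≥0} C_n x^n.) -/
/-- `σ` contains the pattern `τ`. -/
def ContainsPat {n k : ℕ} (σ : Equiv.Perm (Fin n)) (τ : Equiv.Perm (Fin k)) : Prop :=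
  ∃ f : Fin k → Fin n, StrictMono f ∧ ∀ a b : Fin k, σ (f a) < σ (f b) ↔ τ a < τ b

/-- `σ` avoids every pattern in the set `B`. -/
def AvoidsAll {n : ℕ} (B : Set (Σ k, Equiv.Perm (Fin k))) (σ : Equiv.Perm (Fin n)) : Prop :=
  ∀ p ∈ B, ¬ ContainsPat σ p.2

/-- The pattern 1243 (0-based one-line notation). -/
noncomputable def p1243 : Equiv.Perm (Fin 4) :=
  Equiv.ofBijective ![0, 1, 3, 2] (by decide)

/-- The pattern 1324 (0-based one-line notation). -/
noncomputable def p1324 : Equiv.Perm (Fin 4) :=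
  Equiv.ofBijective ![0, 2, 1, 3] (by decide)

/-- The pattern 1342 (0-based one-line notation). -/
noncomputable def p1342 : Equiv.Perm (Fin 4) :=
  Equiv.ofBijective ![0, 2, 3, 1] (by decide)

/-- The pattern 1423 (0-based one-line notation). -/
noncomputable def p1423 : Equiv.Perm (Fin 4) :=
  Equiv.ofBijective ![0, 3, 1, 2] (by decide)

/-- The pattern 1432 (0-based one-line notation). -/
noncomputable def p1432 : Equiv.Perm (Fin 4) :=
  Equiv.ofBijective ![0, 3, 2, 1] (by decide)

/-- The pattern 2143 (0-based one-line notation). -/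
noncomputable def p2143 : Equiv.Perm (Fin 4) :=
  Equiv.ofBijective ![1, 0, 3, 2] (by decide)

/-- The pattern 2413 (0-based one-line notation). -/
noncomputable def p2413 : Equiv.Perm (Fin 4) :=
  Equiv.ofBijective ![1, 3, 0, 2] (by decide)

/-- The pattern 2431 (0-based one-line notation). -/
noncomputable def p2431 : Equiv.Perm (Fin 4) :=
  Equiv.ofBijective ![1, 3, 2, 0] (by decide)

/-- The pattern 3142 (0-based one-line notation). -/
noncomputable def p3142 : Equiv.Perm (Fin 4) :=
  Equiv.ofBijective ![2, 0, 3, 1] (by decide)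

/-- The pattern 4132 (0-based one-line notation). -/
noncomputable def p4132 : Equiv.Perm (Fin 4) :=
  Equiv.ofBijective ![3, 0, 2, 1] (by decide)

noncomputable def a17 (n : ℕ) : ℕ :=
  Nat.card {σ : Equiv.Perm (Fin n) //
    AvoidsAll ({⟨4, p1243⟩, ⟨4, p1324⟩, ⟨4, p1342⟩, ⟨4, p1423⟩, ⟨4, p1432⟩, ⟨4, p2143⟩, ⟨4, p2413⟩, ⟨4, p2431⟩, ⟨4, p3142⟩, ⟨4, p4132⟩} : Set (Σ k, Equiv.Perm (Fin k))) σ}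

/-- A list avoids the pattern 132. -/
def Av (l : List ℕ) : Prop := ∀ x y z, [x, y, z].Sublist l → ¬ (x < z ∧ z < y)

/-- The 132-avoiding list attached to a binary tree. -/
def treeList : BinaryTree Unit → ℕ → List ℕ
  | .nil, _ => []
  | .node _ l r, a =>
    treeList l (a + r.numNodes) ++ (a + (l.numNodes + r.numNodes)) :: treeList r a

theorem av_of_sublist {l l' : List ℕ} (h : l'.Sublist l) (hl : Av l) : Av l' :=
  fun x y z hs => hl x y z (hs.trans h)

theorem treeList_perm (t : BinaryTree Unit) : ∀ a, (treeList t a).Perm (List.range' a t.numNodes) := by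
  induction t with
  | nil => intro a; simp [treeList, BinaryTree.numNodes]
  | node u l r hl hr =>
    intro a
    have e : List.range' a (BinaryTree.node u l r).numNodes =
        (List.range' a r.numNodes ++ List.range' (a + r.numNodes) l.numNodes) ++
          [a + (l.numNodes + r.numNodes)] := by
      rw [List.range'_append_1, BinaryTree.numNodes, List.range'_concat]
      simp [Nat.add_comm]
    rw [e, treeList]
    refine List.perm_middle.trans ?_
    refine List.Perm.trans ?_ (List.perm_append_singleton _ _).symm
    exact ((hl _).append (hr a)|>.trans List.perm_append_comm).cons _

theorem mem_treeList (t : BinaryTree Unit) (a x : ℕ) :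
    x ∈ treeList t a ↔ a ≤ x ∧ x < a + t.numNodes := by
  rw [(treeList_perm t a).mem_iff, List.mem_range'_1]

theorem av_join {l₁ l₂ : List ℕ} {m : ℕ} (h₁ : Av l₁) (h₂ : Av l₂)
    (hlt₁ : ∀ x ∈ l₁, x < m) (hlt₂ : ∀ x ∈ l₂, x < m) (h : ∀ x ∈ l₁, ∀ z ∈ l₂, z < x) :
    Av (l₁ ++ m :: l₂) := by
  rintro x y z hs ⟨hxz, hzy⟩
  have hmem : y ∈ l₁ ++ m :: l₂ := hs.subset (by simp)
  have hym : y ≤ m := by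
    simp only [List.mem_append, List.mem_cons] at hmem
    rcases hmem with hy | hy | hy
    · exact (hlt₁ y hy).le
    · exact hy.le
    · exact (hlt₂ y hy).le
  obtain ⟨s₁, s₂, e, k₁, k₂⟩ := List.sublist_append_iff.1 hs
  have hz : s₂ ≠ [] → z ∈ l₂ := by
    intro hne
    have : z ∈ s₂ := by
      have h3 : ([x, y, z]).getLast (by simp) = s₂.getLast hne := by
        simp only [e, List.getLast_append_of_ne_nil _ hne]
      simp only [List.getLast_cons_cons, List.getLast_singleton] at h3
      rw [h3]; exact List.getLast_mem hne
    rcases List.mem_cons.1 (k₂.subset this) with hh | hh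
    · omega
    · exact hh
  rcases s₁ with _ | ⟨x', s₁⟩
  · simp only [List.nil_append] at e
    subst e
    rcases List.sublist_cons_iff.1 k₂ with hh | ⟨r, hr, -⟩
    · exact h₂ x y z hh ⟨hxz, hzy⟩
    · simp only [List.cons.injEq] at hr
      omega
  · have hx : x' = x := by simp at e; exact e.1.symm
    subst hx
    by_cases hne : s₂ = []
    · subst hne
      rw [List.append_nil] at e
      rw [← e] at k₁
      exact h₁ _ y z k₁ ⟨hxz, hzy⟩
    · have := h x' (k₁.subset (by simp)) z (hz hne)
      omega

theorem treeList_av (t : BinaryTree Unit) : ∀ a, Av (treeList t a) := by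
  induction t with
  | nil => intro a x y z h; simp [treeList] at h
  | node u l r hl hr =>
    intro a
    rw [treeList]
    apply av_join (hl _) (hr _)
    all_goals simp only [mem_treeList]
    all_goals intros
    all_goals omega

theorem treeList_length (t : BinaryTree Unit) (a : ℕ) : (treeList t a).length = t.numNodes := by
  simpa using (treeList_perm t a).length_eq

theorem treeList_inj (t : BinaryTree Unit) : ∀ t' a, treeList t a = treeList t' a → t = t' := by
  induction t with
  | nil =>
    intro t' a h
    cases t' with
    | nil => rfl
    | node u l r => simp [treeList] at h
  | node u l r hl hr =>
    intro t' a h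
    cases t' with
    | nil => simp [treeList] at h
    | node u' l' r' =>
      have hlen := congrArg List.length h
      rw [treeList_length, treeList_length, BinaryTree.numNodes, BinaryTree.numNodes] at hlen
      rw [treeList, treeList, List.append_cons_inj_of_notMem] at h
      · obtain ⟨e1, -, e2⟩ := h
        have := hr _ _ e2
        subst this
        have := hl _ _ e1
        subst this
        rfl
      · rw [mem_treeList]; omega
      · rw [mem_treeList]; omega

theorem split_range {l₁ l₂ : List ℕ} {a : ℕ} (h : ∀ x ∈ l₁, ∀ z ∈ l₂, z < x)
    (hp : (l₂ ++ l₁).Perm (List.range' a (l₂.length + l₁.length))) :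
    l₂.Perm (List.range' a l₂.length) ∧
      l₁.Perm (List.range' (a + l₂.length) l₁.length) := by
  have p1 := List.perm_insertionSort (· ≤ ·) l₁
  have p2 := List.perm_insertionSort (· ≤ ·) l₂
  have e : l₂.insertionSort (· ≤ ·) ++ l₁.insertionSort (· ≤ ·) =
      List.range' a l₂.length ++ List.range' (a + l₂.length) l₁.length := by
    rw [List.range'_append_1]
    apply List.Perm.eq_of_pairwise' (r := (· ≤ ·)) _ _ ((p2.append p1).trans hp)
    · rw [List.pairwise_append]
      refine ⟨List.pairwise_insertionSort _ _, List.pairwise_insertionSort _ _, ?_⟩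
      intro z hz x hx
      exact (h x (p1.mem_iff.1 hx) z (p2.mem_iff.1 hz)).le
    · exact (List.pairwise_lt_range' (s := a) (n := l₂.length + l₁.length)).imp le_of_lt
  obtain ⟨e1, e2⟩ := List.append_inj e (by simp)
  rw [← e1, ← e2]
  exact ⟨p2.symm, p1.symm⟩

theorem treeList_surj : ∀ n a (l : List ℕ), l.Perm (List.range' a n) → Av l →
    ∃ t : BinaryTree Unit, t.numNodes = n ∧ treeList t a = l := by
  intro n
  induction n using Nat.strong_induction_on with
  | _ n ih =>
  intro a l hp hav
  rcases n with _ | n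
  · refine ⟨.nil, rfl, ?_⟩
    simp at hp
    simp [treeList, hp]
  · have hm : a + n ∈ l := by rw [hp.mem_iff, List.mem_range'_1]; omega
    obtain ⟨l₁, l₂, rfl⟩ := List.append_of_mem hm
    have hp' : (l₁ ++ l₂).Perm (List.range' a n) := by
      have h1 := (List.perm_middle.symm.trans hp)
      rw [List.range'_concat, Nat.one_mul] at h1
      exact (h1.trans (List.perm_append_singleton _ _)).cons_inv
    have hlen : l₁.length + l₂.length = n := by simpa using hp'.length_eq
    have hnd : (l₁ ++ l₂).Nodup := hp'.nodup_iff.2 List.nodup_range'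
    have hlt : ∀ x ∈ l₁ ++ l₂, x < a + n := fun x hx => by
      have := hp'.mem_iff.1 hx
      rw [List.mem_range'_1] at this; omega
    have hsep : ∀ x ∈ l₁, ∀ z ∈ l₂, z < x := by
      intro x hx z hz
      have hne : x ≠ z := (List.nodup_append.1 hnd).2.2 x hx z hz
      by_contra hcon
      refine hav x (a + n) z ?_ ⟨by omega, hlt z (by simp [hz])⟩
      exact (List.singleton_sublist.2 hx).append ((List.singleton_sublist.2 hz).cons_cons _)
    obtain ⟨q2, q1⟩ := split_range (a := a) hsep
      (List.perm_append_comm.trans (by rw [Nat.add_comm, hlen]; exact hp'))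
    obtain ⟨t2, n2, e2⟩ := ih l₂.length (by omega) a l₂ q2
      (av_of_sublist ((List.sublist_cons_self _ _).trans (List.sublist_append_right _ _)) hav)
    obtain ⟨t1, n1, e1⟩ := ih l₁.length (by omega) _ l₁ q1
      (av_of_sublist (List.sublist_append_left _ _) hav)
    refine ⟨.node () t1 t2, by simp only [BinaryTree.numNodes]; omega, ?_⟩
    rw [treeList, n2, e1, e2, n1, hlen]

theorem card_av_lists (n : ℕ) :
    Nat.card {l : List ℕ // l.Perm (List.range' 0 n) ∧ Av l} = catalan n := by
  rw [← BinaryTree.treesOfNumNodesEq_card_eq_catalan, ← Nat.card_eq_finsetCard]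
  symm
  refine Nat.card_eq_of_bijective (fun t => ⟨treeList t.1 0, ?_, treeList_av _ _⟩) ⟨?_, ?_⟩
  · have h := treeList_perm t.1 0
    rwa [BinaryTree.mem_treesOfNumNodesEq.1 t.2] at h
  · intro t t' h
    exact Subtype.ext (treeList_inj _ _ 0 (congrArg Subtype.val h))
  · rintro ⟨l, hp, hav⟩
    obtain ⟨t, ht, e⟩ := treeList_surj n 0 l hp hav
    exact ⟨⟨t, BinaryTree.mem_treesOfNumNodesEq.2 ht⟩, Subtype.ext e⟩

/-- A permutation contains 132. -/
def Has132 {n : ℕ} (σ : Equiv.Perm (Fin n)) : Prop :=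
  ∃ i j k : Fin n, i < j ∧ j < k ∧ σ i < σ k ∧ σ k < σ j

theorem has_iff {n : ℕ} (σ : Equiv.Perm (Fin n)) :
    Av (List.ofFn fun i => (σ i : ℕ)) ↔ ¬ Has132 σ := by
  constructor
  · rintro h ⟨i, j, k, hij, hjk, h1, h2⟩
    refine h (σ i) (σ j) (σ k) ?_ ⟨h1, h2⟩
    have := List.map_getElem_sublist (l := List.ofFn fun i => (σ i : ℕ))
      (is := [Fin.cast (by simp) i, Fin.cast (by simp) j, Fin.cast (by simp) k])
      (by simp [hij, hjk, hij.trans hjk])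
    simpa using this
  · rintro h x y z hs ⟨h1, h2⟩
    obtain ⟨is, e, hp⟩ := List.sublist_eq_map_getElem hs
    rcases is with _ | ⟨i, _ | ⟨j, _ | ⟨k, _ | ⟨m, is⟩⟩⟩⟩ <;> simp at e
    obtain ⟨rfl, rfl, rfl⟩ := e
    simp at hp
    exact h ⟨_, _, _, hp.1.1, hp.2, h1, h2⟩

theorem contains_of {n : ℕ} (σ : Equiv.Perm (Fin n)) (i₀ i₁ i₂ i₃ : Fin n)
    (h₀ : i₀ < i₁) (h₁ : i₁ < i₂) (h₂ : i₂ < i₃) (τ : Equiv.Perm (Fin 4))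
    (h : ∀ a b : Fin 4, σ (![i₀, i₁, i₂, i₃] a) < σ (![i₀, i₁, i₂, i₃] b) ↔ τ a < τ b) :
    ContainsPat σ τ := by
  refine ⟨![i₀, i₁, i₂, i₃], ?_, h⟩
  rw [Fin.strictMono_iff_lt_succ]
  intro i
  fin_cases i <;> assumption

theorem has_of_contains {n : ℕ} (σ : Equiv.Perm (Fin n)) (τ : Equiv.Perm (Fin 4))
    (hc : ContainsPat σ τ) (h : Has132 τ) : Has132 σ := by
  obtain ⟨f, hf, hc⟩ := hc
  obtain ⟨i, j, k, h1, h2, h3, h4⟩ := h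
  exact ⟨f i, f j, f k, hf h1, hf h2, (hc _ _).2 h3, (hc _ _).2 h4⟩

theorem avoids_iff {n : ℕ} (hn : n ≠ 3) (σ : Equiv.Perm (Fin n)) :
    AvoidsAll ({⟨4, p1243⟩, ⟨4, p1324⟩, ⟨4, p1342⟩, ⟨4, p1423⟩, ⟨4, p1432⟩, ⟨4, p2143⟩, ⟨4, p2413⟩, ⟨4, p2431⟩, ⟨4, p3142⟩, ⟨4, p4132⟩} : Set (Σ k, Equiv.Perm (Fin k))) σ ↔ ¬ Has132 σ := by
  simp only [AvoidsAll, Set.mem_insert_iff, Set.mem_singleton_iff, forall_eq_or_imp, forall_eq]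
  constructor
  · rintro ⟨n1, n2, n3, n4, n5, n6, n7, n8, n9, n10⟩ ⟨i, j, k, hij, hjk, h1, h2⟩
    obtain ⟨d, di, dj, dk⟩ : ∃ d : Fin n, d ≠ i ∧ d ≠ j ∧ d ≠ k := by
      by_contra hcon
      push Not at hcon
      have : (Finset.univ : Finset (Fin n)) ⊆ {i, j, k} := by
        intro d _
        have := hcon d
        simp only [Finset.mem_insert, Finset.mem_singleton]
        tauto
      have h3 := (Finset.card_le_card this).trans Finset.card_le_three
      simp at h3
      omega
    have vi := σ.injective.ne di
    have vj := σ.injective.ne dj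
    have vk := σ.injective.ne dk
    have hpos : d < i ∨ (i < d ∧ d < j) ∨ (j < d ∧ d < k) ∨ k < d := by omega
    have hval : σ d < σ i ∨ (σ i < σ d ∧ σ d < σ k) ∨ (σ k < σ d ∧ σ d < σ j) ∨ σ j < σ d := by
      omega
    rcases hpos with p | ⟨p, p'⟩ | ⟨p, p'⟩ | p
    · have key := contains_of σ d i j k p hij hjk
      rcases hval with v | ⟨v, v'⟩ | ⟨v, v'⟩ | v
      · apply n1; apply key; simp [Fin.forall_fin_succ, p1243]; omega
      · apply n6; apply key; simp [Fin.forall_fin_succ, p2143]; omega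
      · apply n9; apply key; simp [Fin.forall_fin_succ, p3142]; omega
      · apply n10; apply key; simp [Fin.forall_fin_succ, p4132]; omega
    · have key := contains_of σ i d j k p p' hjk
      rcases hval with v | ⟨v, v'⟩ | ⟨v, v'⟩ | v
      · apply n6; apply key; simp [Fin.forall_fin_succ, p2143]; omega
      · apply n1; apply key; simp [Fin.forall_fin_succ, p1243]; omega
      · apply n3; apply key; simp [Fin.forall_fin_succ, p1342]; omega
      · apply n5; apply key; simp [Fin.forall_fin_succ, p1432]; omega
    · have key := contains_of σ i j d k hij p p'
      rcases hval with v | ⟨v, v'⟩ | ⟨v, v'⟩ | v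
      · apply n7; apply key; simp [Fin.forall_fin_succ, p2413]; omega
      · apply n4; apply key; simp [Fin.forall_fin_succ, p1423]; omega
      · apply n5; apply key; simp [Fin.forall_fin_succ, p1432]; omega
      · apply n3; apply key; simp [Fin.forall_fin_succ, p1342]; omega
    · have key := contains_of σ i j k d hij hjk p
      rcases hval with v | ⟨v, v'⟩ | ⟨v, v'⟩ | v
      · apply n8; apply key; simp [Fin.forall_fin_succ, p2431]; omega
      · apply n5; apply key; simp [Fin.forall_fin_succ, p1432]; omega
      · apply n4; apply key; simp [Fin.forall_fin_succ, p1423]; omega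
      · apply n2; apply key; simp [Fin.forall_fin_succ, p1324]; omega
  · intro h
    refine ⟨?_, ?_, ?_, ?_, ?_, ?_, ?_, ?_, ?_, ?_⟩ <;> intro hc <;> apply h <;>
      apply has_of_contains _ _ hc
    · exact ⟨0, 2, 3, by decide, by decide, by decide, by decide⟩
    · exact ⟨0, 1, 2, by decide, by decide, by decide, by decide⟩
    · exact ⟨0, 1, 3, by decide, by decide, by decide, by decide⟩
    · exact ⟨0, 1, 2, by decide, by decide, by decide, by decide⟩
    · exact ⟨0, 1, 2, by decide, by decide, by decide, by decide⟩
    · exact ⟨0, 2, 3, by decide, by decide, by decide, by decide⟩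
    · exact ⟨0, 1, 3, by decide, by decide, by decide, by decide⟩
    · exact ⟨0, 1, 2, by decide, by decide, by decide, by decide⟩
    · exact ⟨1, 2, 3, by decide, by decide, by decide, by decide⟩
    · exact ⟨1, 2, 3, by decide, by decide, by decide, by decide⟩

theorem card_perms (n : ℕ) :
    Nat.card {σ : Equiv.Perm (Fin n) // ¬ Has132 σ} =
      Nat.card {l : List ℕ // l.Perm (List.range' 0 n) ∧ Av l} := by
  refine Nat.card_eq_of_bijective (fun σ => ⟨List.ofFn fun i => (σ.1 i : ℕ), ?_, (has_iff σ.1).2 σ.2⟩) ⟨?_, ?_⟩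
  · rw [← List.range_eq_range']
    rw [List.perm_ext_iff_of_nodup]
    · intro a
      simp only [List.mem_ofFn, List.mem_range]
      constructor
      · rintro ⟨i, rfl⟩; exact (σ.1 i).2
      · intro h; exact ⟨σ.1.symm ⟨a, h⟩, by simp⟩
    · rw [List.nodup_ofFn]
      exact Fin.val_injective.comp σ.1.injective
    · exact List.nodup_range
  · intro σ τ h
    simp only [Subtype.mk.injEq, List.ofFn_inj] at h
    apply Subtype.ext
    ext i
    exact congrFun h i
  · rintro ⟨l, hp, hav⟩
    have hlen : l.length = n := by simpa using hp.length_eq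
    subst hlen
    have hnd : l.Nodup := hp.nodup_iff.2 List.nodup_range'
    have hlt : ∀ i : Fin l.length, l[i] < l.length := fun i => by
      have := hp.mem_iff.1 (List.getElem_mem i.2)
      rw [List.mem_range'_1] at this
      simpa using this
    have hinj : Function.Injective (fun i : Fin l.length => (⟨l[i], hlt i⟩ : Fin l.length)) := by
      intro i j h
      simp only [Fin.mk.injEq] at h
      exact Fin.ext ((hnd.getElem_inj_iff).1 h)
    let σ := Equiv.ofBijective _ (Finite.injective_iff_bijective.1 hinj)
    have e : (List.ofFn fun i => (σ i : ℕ)) = l := by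
      simp [σ]
    exact ⟨⟨σ, (has_iff σ).1 (by rw [e]; exact hav)⟩, Subtype.ext e⟩

theorem a17_eq {n : ℕ} (hn : n ≠ 3) : a17 n = catalan n := by
  rw [← card_av_lists, ← card_perms, a17]
  exact Nat.card_congr (Equiv.subtypeEquivRight fun σ => avoids_iff hn σ)

theorem a17_three : a17 3 = 6 := by
  have h : ∀ (σ : Equiv.Perm (Fin 3)) (τ : Equiv.Perm (Fin 4)), ¬ ContainsPat σ τ := by
    rintro σ τ ⟨f, hf, -⟩
    have := Fintype.card_le_of_injective f hf.injective
    simp at this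
  rw [a17]
  rw [Nat.card_congr (Equiv.subtypeUnivEquiv _)]
  · simp [Nat.card_eq_fintype_card, Fintype.card_perm, Nat.factorial]
  · intro σ
    simp [AvoidsAll, h]

theorem card_avoiders_ten_patterns_B9 :
    a17 3 = 6 ∧ ∀ n : ℕ, 1 ≤ n → n ≠ 3 → (n + 1) * a17 n = Nat.choose (2 * n) n := by
  refine ⟨a17_three, fun n _ hn => ?_⟩
  rw [a17_eq hn, succ_mul_catalan_eq_centralBinom, Nat.centralBinom]
end

section
/- Let B = {123, 312, 21543}. For every n ≥ 2, there is exactly one permutation σ ∈ S_n(B) in which the entry 1 appears to the left of the entry 2 (i.e., σ^{-1}(1) < σ^{-1}(2)). (Equivalently, F_{12}(x) = Σ_{n≥2} #{σ ∈ S_n(B) : σ^{-1}(1) < σ^{-1}(2)} x^n = x²/(1−x).) -/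
/-- The pattern 123 (0-based one-line notation). -/
noncomputable def p123 : Equiv.Perm (Fin 3) :=
  Equiv.ofBijective ![0, 1, 2] (by decide)

/-- The pattern 312 (0-based one-line notation). -/
noncomputable def p312 : Equiv.Perm (Fin 3) :=
  Equiv.ofBijective ![2, 0, 1] (by decide)

/-- The pattern 21543 (0-based one-line notation). -/
noncomputable def p21543 : Equiv.Perm (Fin 5) :=
  Equiv.ofBijective ![1, 0, 4, 3, 2] (by decide)

lemma aux_uniq {m : ℕ} (σ τ : Equiv.Perm (Fin (m + 2)))
    (hσ0 : σ 0 = 0) (hσ : ∀ i j, 0 < i → i < j → σ j < σ i)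
    (hτ0 : τ 0 = 0) (hτ : ∀ i j, 0 < i → i < j → τ j < τ i) : σ = τ := by
  have hmono : StrictMono (τ.symm.trans σ) := by
    intro a b hab
    obtain ⟨x, rfl⟩ := τ.surjective a
    obtain ⟨y, rfl⟩ := τ.surjective b
    simp only [Equiv.trans_apply, Equiv.symm_apply_apply]
    by_cases hx : x = 0
    · subst hx
      rw [hσ0]
      refine Fin.pos_iff_ne_zero.mpr ?_
      intro h
      rw [← hσ0] at h
      rw [σ.injective h] at hab
      exact lt_irrefl _ hab
    · have hy : y ≠ 0 := by
        rintro rfl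
        rw [hτ0] at hab
        exact absurd hab (Fin.not_lt_zero _)
      rcases lt_trichotomy x y with h | h | h
      · exact absurd hab (not_lt.mpr (hτ x y (Fin.pos_iff_ne_zero.mpr hx) h).le)
      · subst h
        exact absurd hab (lt_irrefl _)
      · exact hσ y x (Fin.pos_iff_ne_zero.mpr hy) h
  have hle : ∀ a b, (τ.symm.trans σ) a ≤ (τ.symm.trans σ) b ↔ a ≤ b := fun a b => hmono.le_iff_le
  let e : Fin (m + 2) ≃o Fin (m + 2) := ⟨τ.symm.trans σ, fun {a b} => hle a b⟩
  have he : e = OrderIso.refl _ := Subsingleton.elim _ _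
  ext x
  have := congrArg (fun f : Fin (m + 2) ≃o Fin (m + 2) => f (τ x)) he
  have h2 : σ (τ.symm (τ x)) = τ x := this
  rw [Equiv.symm_apply_apply] at h2
  rw [h2]

lemma aux_char {m : ℕ} (σ : Equiv.Perm (Fin (m + 2))) :
    (AvoidsAll ({⟨3, p123⟩, ⟨3, p312⟩, ⟨5, p21543⟩} : Set (Σ k, Equiv.Perm (Fin k))) σ ∧
        σ.symm ⟨0, by omega⟩ < σ.symm ⟨1, by omega⟩) ↔
    (σ 0 = 0 ∧ ∀ i j, 0 < i → i < j → σ j < σ i) := by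
  constructor
  · rintro ⟨hav, hlt⟩
    have h123 : ¬ ContainsPat σ p123 := hav ⟨3, p123⟩ (by simp)
    have h312 : ¬ ContainsPat σ p312 := hav ⟨3, p312⟩ (by simp)
    obtain ⟨p, hp⟩ : ∃ p, p = σ.symm ⟨0, by omega⟩ := ⟨_, rfl⟩
    obtain ⟨q, hq⟩ : ∃ q, q = σ.symm ⟨1, by omega⟩ := ⟨_, rfl⟩
    rw [← hp, ← hq] at hlt
    have hp' : (σ p).val = 0 := by rw [hp]; simp
    have hq' : (σ q).val = 1 := by rw [hq, Equiv.apply_symm_apply]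
    have h0 : σ 0 = 0 := by
      by_contra hne
      have hp0 : 0 < p := by
        refine Fin.pos_iff_ne_zero.mpr ?_
        rintro rfl
        exact hne (Fin.ext (by simpa using hp'))
      have hz0 : (σ 0).val ≠ 0 := fun h => hne (Fin.ext (by simpa using h))
      have hz1 : (σ 0).val ≠ 1 := by
        intro h
        have := σ.injective (Fin.ext (h.trans hq'.symm))
        rw [← this] at hlt
        exact absurd hlt (Fin.not_lt_zero _)
      have hpq : σ p < σ q := by rw [Fin.lt_def]; omega
      have hqz : σ q < σ 0 := by rw [Fin.lt_def]; omega
      apply h312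
      refine ⟨![0, p, q], ?_, ?_⟩
      · rw [Fin.strictMono_iff_lt_succ]
        intro i
        fin_cases i
        · exact hp0
        · exact hlt
      · intro a b
        fin_cases a <;> fin_cases b <;> simp [p312] <;> order
    refine ⟨h0, ?_⟩
    intro i j hi hij
    by_contra hle
    have hlt' : σ i < σ j :=
      lt_of_le_of_ne (not_lt.mp hle) (fun h => hij.ne (σ.injective h))
    have hi0 : σ 0 < σ i := by
      rw [h0]
      refine Fin.pos_iff_ne_zero.mpr (fun h => ?_)
      rw [← h0] at h
      exact hi.ne' (σ.injective h)
    apply h123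
    refine ⟨![0, i, j], ?_, ?_⟩
    · rw [Fin.strictMono_iff_lt_succ]
      intro k
      fin_cases k
      · exact hi
      · exact hij
    · intro a b
      fin_cases a <;> fin_cases b <;> simp [p123] <;> order
  · rintro ⟨h0, hanti⟩
    -- no ascent can start at a positive position
    have key : ∀ {i j k : Fin (m + 2)}, k < i → i < j → ¬ σ i < σ j := fun hk hij h =>
      absurd h (not_lt.mpr (hanti _ _ (lt_of_le_of_lt (Fin.zero_le _) hk) hij).le)
    refine ⟨?_, ?_⟩
    · intro x hx
      simp only [Set.mem_insert_iff, Set.mem_singleton_iff] at hx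
      rcases hx with rfl | rfl | rfl
      · rintro ⟨f, hf, h⟩
        exact key (hf (show (0 : Fin 3) < 1 by decide)) (hf (show (1 : Fin 3) < 2 by decide))
          ((h 1 2).mpr (by simp [p123]))
      · rintro ⟨f, hf, h⟩
        exact key (hf (show (0 : Fin 3) < 1 by decide)) (hf (show (1 : Fin 3) < 2 by decide))
          ((h 1 2).mpr (by simp [p312]))
      · rintro ⟨f, hf, h⟩
        exact key (hf (show (0 : Fin 5) < 1 by decide)) (hf (show (1 : Fin 5) < 2 by decide))
          ((h 1 2).mpr (by simp [p21543]))
    · have e0 : σ.symm ⟨0, by omega⟩ = 0 := by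
        rw [Equiv.symm_apply_eq, h0]; rfl
      rw [e0]
      refine Fin.pos_iff_ne_zero.mpr (fun h => ?_)
      rw [Equiv.symm_apply_eq, h0] at h
      exact absurd (congrArg Fin.val h) (by simp)

theorem card_avoiders_123_312_21543_one_before_two (n : ℕ) (hn : 2 ≤ n) :
    Nat.card {σ : Equiv.Perm (Fin n) //
        AvoidsAll ({⟨3, p123⟩, ⟨3, p312⟩, ⟨5, p21543⟩} : Set (Σ k, Equiv.Perm (Fin k))) σ ∧
        σ.symm ⟨0, by omega⟩ < σ.symm ⟨1, by omega⟩} = 1 := by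
  obtain ⟨m, rfl⟩ : ∃ m, n = m + 2 := ⟨n - 2, by omega⟩
  rw [Nat.card_eq_one_iff_unique]
  refine ⟨⟨?_⟩, ?_⟩
  · rintro ⟨σ, hσ⟩ ⟨τ, hτ⟩
    obtain ⟨a, b⟩ := (aux_char σ).mp hσ
    obtain ⟨c, d⟩ := (aux_char τ).mp hτ
    exact Subtype.ext (aux_uniq σ τ a b c d)
  · refine ⟨⟨Equiv.neg (Fin (m + 2)), (aux_char _).mpr ⟨by simp, ?_⟩⟩⟩
    intro i j hi hij
    have hj : 0 < j := hi.trans hij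
    simp only [Equiv.neg_apply, Fin.lt_def, Fin.val_neg, Fin.val_zero] at *
    rw [if_neg (by rintro rfl; simp at hj), if_neg (by rintro rfl; simp at hi)]
    omega
end
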